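/- arXiv:1012.0996 — 2 statements merged into one kernel-verified Lean document; each statement's English description precedes it below -/
import Mathlib

section
/- Let (Θ,d) be a complete separable metric space and let M be a Borel probability measure on Θ^ℕ₀ that is stationary and ergodic for the shift T(θ(0),θ(1),…) = (θ(1),θ(2),…), with invariant (one-dimensional marginal) probability measure Π on Θ. Let e_m be the empirical distribution map. Then R_m(M,Π) = ∫_{Θ^ℕ₀} w(e_m(θ(0),…,θ(m−1)), Π) M(dθ_∞) → 0 as m → ∞. -/
open MeasureTheory ProbabilityTheory Filter Topology Matrix ENNReal

/-- The class `BL₁(Θ)` of Borel measurable functions `f : Θ → ℝ` with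
`|f s - f t| ≤ d(s,t)` for all `s, t`. -/
def BLone (Θ : Type*) [MeasurableSpace Θ] [PseudoMetricSpace Θ] : Set (Θ → ℝ) :=
  {f | Measurable f ∧ ∀ s t : Θ, |f s - f t| ≤ dist s t}

/-- The bounded Lipschitz distance `w(μ,ν) = sup_{f ∈ BL₁} |∫ f dμ - ∫ f dν|`. -/
noncomputable def blDist {Θ : Type*} [MeasurableSpace Θ] [PseudoMetricSpace Θ]
    (μ ν : Measure Θ) : ℝ :=
  ⨆ f ∈ BLone Θ, |∫ x, f x ∂μ - ∫ x, f x ∂ν|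

/-- The empirical distribution `e_m(θ(0),…,θ(m-1)) = (1/m) ∑_{i<m} δ_{θ(i)}`. -/
noncomputable def emp {Θ : Type*} [MeasurableSpace Θ] (θ : ℕ → Θ) (m : ℕ) : Measure Θ :=
  (m : ℝ≥0∞)⁻¹ • ∑ i ∈ Finset.range m, Measure.dirac (θ i)

/-- The risk `R_m(M,Π) = ∫ w(e_m(θ(0),…,θ(m-1)), Π) M(dθ_∞)`. -/
noncomputable def risk {Θ : Type*} [MeasurableSpace Θ] [PseudoMetricSpace Θ]
    (M : Measure (ℕ → Θ)) (target : Measure Θ) (m : ℕ) : ℝ :=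
  ∫ θ, blDist (emp θ m) target ∂M

/-- The shift `T(θ(0),θ(1),…) = (θ(1),θ(2),…)` on `Θ^{ℕ₀}`. -/
def shift {Θ : Type*} (θ : ℕ → Θ) : ℕ → Θ := fun i => θ (i + 1)

/-- The Birkhoff averages of an integrable function under a measure preserving map are
integrable. -/
theorem MeasureTheory.MeasurePreserving.integrable_birkhoffAverage {α : Type*}
    [MeasurableSpace α] {μ : Measure α} {T : α → α} (hT : MeasurePreserving T μ μ)
    {φ : α → ℝ} (hφ : Integrable φ μ) (n : ℕ) : Integrable (birkhoffAverage ℝ T φ n) μ :=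
  (integrable_finsetSum _ fun k _ =>
    (hT.iterate k).integrable_comp_of_integrable hφ).const_mul (n : ℝ)⁻¹

/-- Birkhoff averages under a measure preserving map preserve the integral. -/
theorem MeasureTheory.MeasurePreserving.integral_birkhoffAverage {α : Type*}
    [MeasurableSpace α] {μ : Measure α} {T : α → α} (hT : MeasurePreserving T μ μ)
    {φ : α → ℝ} (hφ : Integrable φ μ) {n : ℕ} (hn : 0 < n) :
    ∫ x, birkhoffAverage ℝ T φ n x ∂μ = ∫ x, φ x ∂μ := by
  simp only [birkhoffAverage, birkhoffSum, smul_eq_mul]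
  have hint : ∀ k : ℕ, Integrable (fun x => φ (T^[k] x)) μ := fun k =>
    (hT.iterate k).integrable_comp_of_integrable hφ
  rw [integral_const_mul, integral_finsetSum _ fun k _ => hint k]
  have hterm : ∀ k ∈ Finset.range n, ∫ x, φ (T^[k] x) ∂μ = ∫ x, φ x ∂μ := fun k _ => by
    have hk := hT.iterate k
    rw [← integral_map (μ := μ) hk.measurable.aemeasurable (f := φ)
      (by rw [hk.map_eq]; exact hφ.1), hk.map_eq]
  rw [Finset.sum_congr rfl hterm]
  have hn_ne : (n : ℝ) ≠ 0 := by positivity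
  simp [hn_ne]

/-- **Mean ergodic theorem in `L¹`** for square-integrable observables. -/
theorem Ergodic.tendsto_integral_abs_birkhoffAverage_sub {α : Type*} [MeasurableSpace α]
    {μ : Measure α} [IsProbabilityMeasure μ] {T : α → α} (hT : Ergodic T μ)
    {φ : α → ℝ} (hφ : MemLp φ 2 μ) :
    Tendsto (fun n => ∫ x, |birkhoffAverage ℝ T φ n x - ∫ y, φ y ∂μ| ∂μ) atTop (𝓝 0) := by
  have hmp := hT.toMeasurePreserving
  let U : Lp ℝ 2 μ →L[ℝ] Lp ℝ 2 μ :=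
    (Lp.compMeasurePreservingₗᵢ ℝ T hmp).toContinuousLinearMap
  have hU : ‖U‖ ≤ 1 := LinearIsometry.norm_toContinuousLinearMap_le _
  set F := hφ.toLp φ
  have hlim := U.tendsto_birkhoffAverage_orthogonalProjection hU F
  set P := (U.eqLocus (1 : Lp ℝ 2 μ →L[ℝ] Lp ℝ 2 μ)).orthogonalProjectionOnto F
  obtain ⟨c, hc⟩ : ∃ c, (P : Lp ℝ 2 μ) =ᵐ[μ] Function.const α c := by
    refine hT.ae_eq_const_of_ae_eq_comp_ae (Lp.aestronglyMeasurable _) ?_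
    have h1 : U P = P := P.2
    have h2 := Lp.coeFn_compMeasurePreserving (P : Lp ℝ 2 μ) hmp
    have h3 : Lp.compMeasurePreserving T hmp (P : Lp ℝ 2 μ) = P := h1
    rw [h3] at h2
    exact h2.symm
  have hiter : ∀ n : ℕ, ((U^[n] F : Lp ℝ 2 μ) : α → ℝ) =ᵐ[μ] φ ∘ T^[n] := by
    intro n
    induction n with
    | zero => exact hφ.coeFn_toLp
    | succ n ih =>
      rw [Function.iterate_succ_apply', Function.iterate_succ, ← Function.comp_assoc]
      exact (Lp.coeFn_compMeasurePreserving _ hmp).trans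
        (hmp.quasiMeasurePreserving.ae_eq_comp ih)
  have havg : ∀ n : ℕ, ((birkhoffAverage ℝ U _root_.id n F : Lp ℝ 2 μ) : α → ℝ) =ᵐ[μ]
      birkhoffAverage ℝ T φ n := by
    intro n
    have hsum : ((birkhoffSum U _root_.id n F : Lp ℝ 2 μ) : α → ℝ) =ᵐ[μ] birkhoffSum T φ n := by
      induction n with
      | zero => simpa using Lp.coeFn_zero ℝ 2 μ
      | succ n ih =>
        rw [birkhoffSum_succ]
        filter_upwards [Lp.coeFn_add (birkhoffSum U _root_.id n F) (U^[n] F), ih, hiter n]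
          with x h1 h2 h3
        rw [birkhoffSum_succ, _root_.id, h1, Pi.add_apply, h2, h3, Function.comp_apply]
    filter_upwards [Lp.coeFn_smul (n : ℝ)⁻¹ (birkhoffSum U _root_.id n F), hsum] with x h1 h2
    rw [birkhoffAverage, h1, Pi.smul_apply, h2, birkhoffAverage]
  have hterm : ∀ k : ℕ, MemLp (fun x => φ (T^[k] x)) 2 μ := fun k =>
    hφ.comp_measurePreserving (hmp.iterate k)
  have hmem : ∀ n : ℕ, MemLp (birkhoffAverage ℝ T φ n) 2 μ := fun n =>
    (memLp_finsetSum _ fun k _ => hterm k).const_smul (n : ℝ)⁻¹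
  have hc1 : Tendsto (fun n => ∫ x, |birkhoffAverage ℝ T φ n x - c| ∂μ) atTop (𝓝 0) := by
    refine squeeze_zero (fun n => integral_nonneg fun x => abs_nonneg _) (fun n => ?_)
      (tendsto_iff_norm_sub_tendsto_zero.1 hlim)
    have hd : MemLp (fun x => birkhoffAverage ℝ T φ n x - c) 2 μ :=
      (hmem n).sub (memLp_const c)
    have hnorm : ‖birkhoffAverage ℝ U _root_.id n F - (P : Lp ℝ 2 μ)‖
        = (eLpNorm (fun x => birkhoffAverage ℝ T φ n x - c) 2 μ).toReal := by
      rw [Lp.norm_def]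
      congr 1
      refine eLpNorm_congr_ae ?_
      filter_upwards [Lp.coeFn_sub (birkhoffAverage ℝ U _root_.id n F) (P : Lp ℝ 2 μ), havg n, hc]
        with x h1 h2 h3
      rw [h1, Pi.sub_apply, h2, h3]
      rfl
    rw [hnorm]
    have h1 : ∫ x, |birkhoffAverage ℝ T φ n x - c| ∂μ
        = (eLpNorm (fun x => birkhoffAverage ℝ T φ n x - c) 1 μ).toReal := by
      rw [eLpNorm_one_eq_lintegral_enorm, ← integral_norm_eq_lintegral_enorm hd.1]
      rfl
    rw [h1]
    exact ENNReal.toReal_mono hd.2.ne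
      (eLpNorm_le_eLpNorm_of_exponent_le (by norm_num) hd.1)
  have hconst : ∫ y, φ y ∂μ = c := by
    have h0 : |(∫ y, φ y ∂μ) - c| ≤ 0 := by
      refine ge_of_tendsto hc1 ?_
      filter_upwards [eventually_gt_atTop 0] with n hn
      have : (∫ y, φ y ∂μ) - c = ∫ x, (birkhoffAverage ℝ T φ n x - c) ∂μ := by
        rw [integral_sub ((hmem n).integrable (by norm_num)) (integrable_const c),
          hmp.integral_birkhoffAverage (hφ.integrable (by norm_num)) hn]
        simp
      rw [this]
      exact abs_integral_le_integral_abs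
    exact sub_eq_zero.1 (abs_nonpos_iff.1 h0)
  rwa [hconst]

section Quantization

variable {Θ : Type*} [MetricSpace Θ] [MeasurableSpace Θ]

theorem blDist_nonneg (μ ν : Measure Θ) : 0 ≤ blDist μ ν :=
  Real.iSup_nonneg fun _ => Real.iSup_nonneg fun _ => abs_nonneg _

theorem integrable_of_mem_BLone {μ : Measure Θ} [IsFiniteMeasure μ] {x₀ : Θ}
    (hμ : Integrable (fun x => dist x x₀) μ) {f : Θ → ℝ} (hf : f ∈ BLone Θ) :
    Integrable f μ := by
  refine (hμ.add (integrable_const |f x₀|)).mono' hf.1.aestronglyMeasurable (.of_forall fun x => ?_)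
  have h1 := hf.2 x x₀
  have h2 := abs_add_le (f x - f x₀) (f x₀)
  simp only [sub_add_cancel] at h2
  simp only [Real.norm_eq_abs, Pi.add_apply]
  linarith

/-- The bounded Lipschitz distance is controlled by the quantization errors of a simple map `q`
and the discrepancies on the finitely many cells of `q`. -/
theorem blDist_le_quantization {μ ν : Measure Θ} [IsProbabilityMeasure μ]
    [IsProbabilityMeasure ν] {x₀ : Θ} (hμ : Integrable (fun x => dist x x₀) μ)
    (hν : Integrable (fun x => dist x x₀) ν) (q : SimpleFunc Θ Θ)
    (hqμ : Integrable (fun x => dist x (q x)) μ) (hqν : Integrable (fun x => dist x (q x)) ν) :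
    blDist μ ν ≤ (∫ x, dist x (q x) ∂μ) + (∫ x, dist x (q x) ∂ν)
      + ∑ y ∈ q.range, dist y x₀ * |μ.real (q ⁻¹' {y}) - ν.real (q ⁻¹' {y})| := by
  have hR : 0 ≤ (∫ x, dist x (q x) ∂μ) + (∫ x, dist x (q x) ∂ν)
      + ∑ y ∈ q.range, dist y x₀ * |μ.real (q ⁻¹' {y}) - ν.real (q ⁻¹' {y})| := by
    have h1 : 0 ≤ ∫ x, dist x (q x) ∂μ := integral_nonneg fun x => dist_nonneg
    have h2 : 0 ≤ ∫ x, dist x (q x) ∂ν := integral_nonneg fun x => dist_nonneg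
    positivity
  refine Real.iSup_le (fun f => Real.iSup_le (fun hf => ?_) hR) hR
  have key : ∀ (ρ : Measure Θ) [IsProbabilityMeasure ρ], Integrable (fun x => dist x x₀) ρ →
      Integrable (fun x => dist x (q x)) ρ →
      |(∫ x, f x ∂ρ) - (f x₀ + ∑ y ∈ q.range, (f y - f x₀) * ρ.real (q ⁻¹' {y}))|
        ≤ ∫ x, dist x (q x) ∂ρ := by
    intro ρ _ hρ hqρ
    have hq : Integrable (fun x => (q.map fun y => f y - f x₀) x) ρ :=
      (q.map fun y => f y - f x₀).integrable_of_isFiniteMeasure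
    have h1 : ∫ x, (q.map fun y => f y - f x₀) x ∂ρ
        = ∑ y ∈ q.range, (f y - f x₀) * ρ.real (q ⁻¹' {y}) := by
      have hpt : ∀ x, (q.map fun y => f y - f x₀) x
          = ∑ y ∈ q.range, (f y - f x₀) * (q ⁻¹' {y}).indicator 1 x := fun x => by
        rw [Finset.sum_eq_single_of_mem (q x) (SimpleFunc.mem_range_self q x)]
        · simp
        · intro y _ hy
          simp [Set.indicator, hy.symm]
      simp_rw [hpt]
      have hind : ∀ y, Integrable ((q ⁻¹' {y}).indicator (1 : Θ → ℝ)) ρ := fun y =>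
        (integrable_const (1 : ℝ)).indicator (q.measurableSet_fiber y)
      rw [integral_finsetSum _ fun y _ => (hind y).const_mul _]
      refine Finset.sum_congr rfl fun y _ => ?_
      rw [integral_const_mul, integral_indicator_one (q.measurableSet_fiber y)]
    have hfi := integrable_of_mem_BLone hρ hf
    have h2 : (∫ x, f x ∂ρ) - (f x₀ + ∑ y ∈ q.range, (f y - f x₀) * ρ.real (q ⁻¹' {y}))
        = ∫ x, (f x - f (q x)) ∂ρ := by
      rw [← h1]
      have : ∀ x, f x - f (q x) = (f x - f x₀) - (q.map fun y => f y - f x₀) x := fun x => by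
        simp
      simp_rw [this]
      have hfx : Integrable (fun x => f x - f x₀) ρ := hfi.sub (integrable_const _)
      rw [integral_sub hfx hq, integral_sub hfi (integrable_const _)]
      simp [sub_sub]
    rw [h2]
    refine abs_integral_le_integral_abs.trans
      (integral_mono_of_nonneg (.of_forall fun x => abs_nonneg _) hqρ
        (.of_forall fun x => hf.2 _ _))
  have h1 := key μ hμ hqμ
  have h2 := key ν hν hqν
  have h3 : |(∑ y ∈ q.range, (f y - f x₀) * μ.real (q ⁻¹' {y}))
      - ∑ y ∈ q.range, (f y - f x₀) * ν.real (q ⁻¹' {y})|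
      ≤ ∑ y ∈ q.range, dist y x₀ * |μ.real (q ⁻¹' {y}) - ν.real (q ⁻¹' {y})| := by
    rw [← Finset.sum_sub_distrib]
    refine (Finset.abs_sum_le_sum_abs _ _).trans (Finset.sum_le_sum fun y _ => ?_)
    rw [← mul_sub, abs_mul]
    exact mul_le_mul_of_nonneg_right (hf.2 _ _) (abs_nonneg _)
  rw [abs_le] at *
  constructor <;> linarith [h1.1, h1.2, h2.1, h2.2, h3.1, h3.2]

variable [BorelSpace Θ]

/-- Against a measure with infinite first moment, the supremum defining the bounded Lipschitz
distance is not finite, hence takes the default value `0`. -/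
theorem blDist_eq_zero_of_not_integrable {μ ν : Measure Θ} [IsFiniteMeasure μ]
    [IsFiniteMeasure ν] {x₀ : Θ} (hμ : Integrable (fun x => dist x x₀) μ)
    (hν : ¬ Integrable (fun x => dist x x₀) ν) : blDist μ ν = 0 := by
  refine Real.iSup_of_not_bddAbove fun ⟨C, hC⟩ => hν ?_
  have hdist : Continuous fun x : Θ => dist x x₀ := by fun_prop
  have hmem : ∀ n : ℕ, (fun x => min (dist x x₀) (n : ℝ)) ∈ BLone Θ := fun n =>
    ⟨(hdist.min continuous_const).measurable, fun s t =>
      (abs_min_sub_min_le_max _ _ _ _).trans (by simpa using abs_dist_sub_le s t x₀)⟩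
  have hnn : ∀ (n : ℕ) (x : Θ), 0 ≤ min (dist x x₀) (n : ℝ) := fun n x => by positivity
  have hbound : ∀ n : ℕ, ∫ x, min (dist x x₀) (n : ℝ) ∂ν ≤ C + ∫ x, dist x x₀ ∂μ := by
    intro n
    have h1 := hC ⟨fun x => min (dist x x₀) (n : ℝ), rfl⟩
    simp only [ciSup_pos (hmem n)] at h1
    have h2 : ∫ x, min (dist x x₀) (n : ℝ) ∂μ ≤ ∫ x, dist x x₀ ∂μ :=
      integral_mono (integrable_of_mem_BLone hμ (hmem n)) hμ fun x => min_le_left _ _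
    have h3 := (abs_le.1 h1).1
    linarith
  have hint : ∀ n : ℕ, Integrable (fun x => min (dist x x₀) (n : ℝ)) ν := fun n =>
    (integrable_const (n : ℝ)).mono' (hmem n).1.aestronglyMeasurable
      (.of_forall fun x => by
        rw [Real.norm_of_nonneg (hnn n x)]
        exact min_le_right _ _)
  refine ⟨hdist.measurable.aestronglyMeasurable, ?_⟩
  rw [hasFiniteIntegral_iff_ofReal (.of_forall fun x => dist_nonneg)]
  have hlim : Tendsto (fun n : ℕ => ∫⁻ x, ENNReal.ofReal (min (dist x x₀) (n : ℝ)) ∂ν) atTop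
      (𝓝 (∫⁻ x, ENNReal.ofReal (dist x x₀) ∂ν)) := by
    refine lintegral_tendsto_of_tendsto_of_monotone
      (fun n => (hmem n).1.ennreal_ofReal.aemeasurable) (.of_forall fun x i j hij => ?_)
      (.of_forall fun x => ?_)
    · exact ENNReal.ofReal_le_ofReal (min_le_min_left _ (by exact_mod_cast hij))
    · refine tendsto_const_nhds.congr' ?_
      filter_upwards [eventually_ge_atTop ⌈dist x x₀⌉₊] with n hn
      rw [min_eq_left (Nat.ceil_le.1 hn)]
  refine (le_of_tendsto' hlim fun n => ?_).trans_lt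
    (ENNReal.ofReal_lt_top (r := C + ∫ x, dist x x₀ ∂μ))
  rw [← ofReal_integral_eq_lintegral_ofReal (hint n) (.of_forall (hnn n))]
  exact ENNReal.ofReal_le_ofReal (hbound n)

/-- A measure with finite first moment is quantized by finitely many points up to any error. -/
theorem exists_simpleFunc_integral_dist_lt [TopologicalSpace.SeparableSpace Θ] {ν : Measure Θ}
    {x₀ : Θ} (hν : Integrable (fun x => dist x x₀) ν) {ε : ℝ} (hε : 0 < ε) :
    ∃ q : SimpleFunc Θ Θ, (∀ x, dist x (q x) ≤ dist x x₀) ∧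
      Measurable (fun x => dist x (q x)) ∧ ∫ x, dist x (q x) ∂ν < ε := by
  let q : ℕ → SimpleFunc Θ Θ :=
    SimpleFunc.approxOn _root_.id measurable_id Set.univ x₀ (Set.mem_univ _)
  have : SecondCountableTopology Θ := UniformSpace.secondCountable_of_separable Θ
  have hle : ∀ n x, dist x (q n x) ≤ dist x x₀ := fun n x => by
    have := SimpleFunc.edist_approxOn_le measurable_id (Set.mem_univ x₀) x n
    rw [edist_dist, edist_dist, ENNReal.ofReal_le_ofReal_iff dist_nonneg] at this
    rwa [dist_comm x, dist_comm x]
  have hmeas : ∀ n, Measurable fun x => dist x (q n x) := fun n =>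
    measurable_id.dist (q n).measurable
  have hlim : Tendsto (fun n => ∫ x, dist x (q n x) ∂ν) atTop (𝓝 (∫ _, (0 : ℝ) ∂ν)) := by
    refine tendsto_integral_of_dominated_convergence _
      (fun n => (hmeas n).aestronglyMeasurable) hν (fun n => .of_forall fun x => ?_)
      (.of_forall fun x => ?_)
    · rw [Real.norm_of_nonneg dist_nonneg]
      exact hle n x
    · have := SimpleFunc.tendsto_approxOn measurable_id (Set.mem_univ x₀) (x := x) (by simp)
      simpa using! (tendsto_const_nhds (x := x)).dist this
  rw [integral_zero] at hlim
  obtain ⟨n, hn⟩ := (hlim.eventually (gt_mem_nhds hε)).exists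
  exact ⟨q n, hle n, hmeas n, hn⟩

end Quantization

section Empirical

variable {Θ : Type*}

theorem shift_iterate_apply (k : ℕ) (θ : ℕ → Θ) (i : ℕ) : shift^[k] θ i = θ (i + k) := by
  induction k generalizing θ with
  | zero => rfl
  | succ k ih =>
    rw [Function.iterate_succ_apply, ih, shift]
    congr 1

variable [MeasurableSpace Θ]

theorem isProbabilityMeasure_emp (θ : ℕ → Θ) {m : ℕ} (hm : 0 < m) :
    IsProbabilityMeasure (emp θ m) := by
  constructor
  simp only [emp, Measure.smul_apply, Measure.finsetSum_apply, measure_univ, smul_eq_mul,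
    Finset.sum_const, Finset.card_range, nsmul_eq_mul, mul_one]
  exact ENNReal.inv_mul_cancel (by exact_mod_cast hm.ne') (ENNReal.natCast_ne_top m)

theorem integrable_emp (θ : ℕ → Θ) {m : ℕ} (hm : 0 < m) {φ : Θ → ℝ} (hφ : Measurable φ) :
    Integrable φ (emp θ m) := by
  refine Integrable.smul_measure ?_ (ENNReal.inv_ne_top.2 (by exact_mod_cast hm.ne'))
  rw [integrable_finsetSum_measure]
  intro i _
  exact ⟨hφ.aestronglyMeasurable, by simp [HasFiniteIntegral, lintegral_dirac' _ hφ.enorm]⟩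

theorem integral_emp (θ : ℕ → Θ) (m : ℕ) {φ : Θ → ℝ} (hφ : Measurable φ) :
    ∫ x, φ x ∂(emp θ m) = birkhoffAverage ℝ shift (fun θ => φ (θ 0)) m θ := by
  rw [emp, integral_smul_measure, integral_finsetSum_measure]
  · simp [birkhoffAverage, birkhoffSum, shift_iterate_apply,
      integral_dirac' _ _ hφ.stronglyMeasurable]
  · intro i _
    exact ⟨hφ.aestronglyMeasurable, by simp [HasFiniteIntegral, lintegral_dirac' _ hφ.enorm]⟩

theorem measureReal_emp (θ : ℕ → Θ) (m : ℕ) {s : Set Θ} (hs : MeasurableSet s) :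
    (emp θ m).real s = birkhoffAverage ℝ shift (fun θ => s.indicator (1 : Θ → ℝ) (θ 0)) m θ := by
  rw [← integral_emp θ m (measurable_one.indicator hs), integral_indicator_one hs]

end Empirical

/-- If `M` is a shift-stationary and ergodic Borel probability measure on
`Θ^{ℕ₀}`, `Θ` a complete separable metric space, with invariant one-dimensional marginal
`Π`, then `R_m(M,Π) = ∫ w(e_m(θ), Π) M(dθ_∞) → 0` as `m → ∞`. -/
theorem stationary_ergodic_consistent {Θ : Type*} [MetricSpace Θ] [CompleteSpace Θ]
    [TopologicalSpace.SeparableSpace Θ] [MeasurableSpace Θ] [BorelSpace Θ]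
    (M : Measure (ℕ → Θ)) [IsProbabilityMeasure M]
    (hergodic : Ergodic shift M)
    (target : Measure Θ) (htarget : target = M.map fun θ => θ 0) :
    Tendsto (fun m => risk M target m) atTop (𝓝 0) := by

  obtain ⟨x₀⟩ : Nonempty Θ := by
    obtain ⟨θ⟩ := nonempty_of_isProbabilityMeasure M
    exact ⟨θ 0⟩
  have : SecondCountableTopology Θ := UniformSpace.secondCountable_of_separable Θ
  have heval : Measurable fun θ : ℕ → Θ => θ 0 := measurable_pi_apply 0
  have hmp := hergodic.toMeasurePreserving
  have hprob : IsProbabilityMeasure target := htarget ▸ Measure.isProbabilityMeasure_map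
    heval.aemeasurable
  have hproj : MeasurePreserving (fun θ : ℕ → Θ => θ 0) M target := ⟨heval, htarget.symm⟩
  have hintegral : ∀ {φ : Θ → ℝ}, Measurable φ → ∫ θ, φ (θ 0) ∂M = ∫ x, φ x ∂target :=
    fun {φ} hφ => by
      rw [htarget, integral_map heval.aemeasurable hφ.aestronglyMeasurable]
  have hdist : Measurable fun x : Θ => dist x x₀ := by fun_prop
  by_cases hmom : Integrable (fun x => dist x x₀) target
  swap
  · refine tendsto_const_nhds.congr' ?_
    filter_upwards [eventually_gt_atTop 0] with m hm
    have hzero : ∀ θ, blDist (emp θ m) target = 0 := fun θ =>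
      have := isProbabilityMeasure_emp θ hm
      blDist_eq_zero_of_not_integrable (integrable_emp θ hm hdist) hmom
    simp [risk, hzero]
  have hrisk : ∀ m, 0 ≤ risk M target m := fun m => integral_nonneg fun θ => blDist_nonneg _ _
  rw [Metric.tendsto_atTop']
  intro ε hε
  obtain ⟨q, hqle, hqmeas, hqlt⟩ := exists_simpleFunc_integral_dist_lt hmom
    (show 0 < ε / 3 by positivity)
  have hqint : Integrable (fun x => dist x (q x)) target :=
    hmom.mono' hqmeas.aestronglyMeasurable (.of_forall fun x => by
      rw [Real.norm_of_nonneg dist_nonneg]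
      exact hqle x)
  let cell : Θ → (ℕ → Θ) → ℝ := fun y θ => (q ⁻¹' {y}).indicator (1 : Θ → ℝ) (θ 0)
  have hcell : ∀ y, MemLp (cell y) 2 M := fun y =>
    ((memLp_const (1 : ℝ)).indicator (q.measurableSet_fiber y)).comp_measurePreserving hproj
  have hcellint : ∀ y, ∫ θ, cell y θ ∂M = target.real (q ⁻¹' {y}) := fun y => by
    rw [hintegral (measurable_one.indicator (q.measurableSet_fiber y)),
      integral_indicator_one (q.measurableSet_fiber y)]
  have herr : Integrable (fun θ : ℕ → Θ => dist (θ 0) (q (θ 0))) M :=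
    hproj.integrable_comp_of_integrable hqint
  have hdev : ∀ m y, Integrable
      (fun θ => dist y x₀ * |birkhoffAverage ℝ shift (cell y) m θ - ∫ θ', cell y θ' ∂M|) M :=
    fun m y => (((hmp.integrable_birkhoffAverage ((hcell y).integrable (by norm_num)) m).sub
      (integrable_const _)).abs).const_mul _
  have hbound : ∀ m, 0 < m → risk M target m ≤ (∫ x, dist x (q x) ∂target)
      + (∫ x, dist x (q x) ∂target) + ∑ y ∈ q.range, dist y x₀ *
        ∫ θ, |birkhoffAverage ℝ shift (cell y) m θ - ∫ θ', cell y θ' ∂M| ∂M := by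
    intro m hm
    have havg := hmp.integrable_birkhoffAverage herr m
    have hsum := integrable_finsetSum q.range fun y _ => hdev m y
    have hfirst : Integrable (fun θ => birkhoffAverage ℝ shift
        (fun θ : ℕ → Θ => dist (θ 0) (q (θ 0))) m θ + ∫ x, dist x (q x) ∂target) M :=
      havg.add (integrable_const _)
    have hle : risk M target m ≤ ∫ θ, (birkhoffAverage ℝ shift
        (fun θ : ℕ → Θ => dist (θ 0) (q (θ 0))) m θ + (∫ x, dist x (q x) ∂target)
        + ∑ y ∈ q.range, dist y x₀ *
          |birkhoffAverage ℝ shift (cell y) m θ - ∫ θ', cell y θ' ∂M|) ∂M := by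
      refine integral_mono_of_nonneg (.of_forall fun θ => blDist_nonneg _ _) (hfirst.add hsum)
        (.of_forall fun θ => ?_)
      have := isProbabilityMeasure_emp θ hm
      refine (blDist_le_quantization (integrable_emp θ hm hdist) hmom q
        (integrable_emp θ hm hqmeas) hqint).trans_eq ?_
      simp only [integral_emp θ m hqmeas, measureReal_emp θ m (q.measurableSet_fiber _),
        hcellint, cell]
    rw [integral_add hfirst hsum, integral_add havg (integrable_const _),
      hmp.integral_birkhoffAverage herr hm, hintegral hqmeas,
      integral_finsetSum _ fun y _ => hdev m y] at hle
    simpa [integral_const_mul] using hle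
  have hlim : Tendsto (fun m => ∑ y ∈ q.range, dist y x₀ *
      ∫ θ, |birkhoffAverage ℝ shift (cell y) m θ - ∫ θ', cell y θ' ∂M| ∂M) atTop (𝓝 0) := by
    simpa using tendsto_finsetSum q.range fun y _ =>
      (hergodic.tendsto_integral_abs_birkhoffAverage_sub (hcell y)).const_mul (dist y x₀)
  obtain ⟨N, hN⟩ := eventually_atTop.1
    (hlim.eventually (gt_mem_nhds (show 0 < ε / 3 by positivity)))
  refine ⟨N, fun m hm => ?_⟩
  rw [Real.dist_eq, sub_zero, abs_of_nonneg (hrisk m)]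
  have h1 := hbound m (by omega)
  have h2 := hN m hm.le
  linarith
end

section
/- Let (Θ,d) be a complete separable metric space with d ≤ 1. For i = 1,2 and n = 1,2,… let K_n^i be a Markov probability transition kernel on Θ with invariant probability measure Π_n^i, and let M_n^i be the Markov measure on Θ^ℕ₀ generated by (Π_n^i, K_n^i) (which is stationary). If the total variation distance ‖Π_n^1 ⊗ K_n^1 − Π_n^2 ⊗ K_n^2‖ → 0 as n → ∞, where (Π ⊗ K)(dθ,dθ*) = Π(dθ)K(θ,dθ*) is a probability measure on Θ², then w_∞(M_n^1, M_n^2) → 0, where w_∞ is the bounded Lipschitz metric on probability measures on Θ^ℕ₀ induced by d_∞(θ¹_∞,θ²_∞) = Σ_{i=0}^∞ 2^{−i−1} d(θ¹(i),θ²(i)). -/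
open MeasureTheory ProbabilityTheory Filter Topology Matrix ENNReal

/-- The metric `d_∞(θ¹,θ²) = ∑_i 2^{-i-1} d(θ¹(i),θ²(i))` on `Θ^{ℕ₀}`. -/
noncomputable def dInfty {Θ : Type*} [PseudoMetricSpace Θ] (a b : ℕ → Θ) : ℝ :=
  ∑' i : ℕ, (2 : ℝ)⁻¹ ^ (i + 1) * dist (a i) (b i)

/-- Measurable functions on `Θ^{ℕ₀}` that are `1`-Lipschitz for the metric `d_∞`. -/
def BLoneSeq (Θ : Type*) [MeasurableSpace Θ] [PseudoMetricSpace Θ] : Set ((ℕ → Θ) → ℝ) :=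
  {f | Measurable f ∧ ∀ a b : ℕ → Θ, |f a - f b| ≤ dInfty a b}

/-- The bounded Lipschitz distance `w_∞` on (probability) measures on `Θ^{ℕ₀}`,
induced by the metric `d_∞`. -/
noncomputable def blDistInfty {Θ : Type*} [MeasurableSpace Θ] [PseudoMetricSpace Θ]
    (M N : Measure (ℕ → Θ)) : ℝ :=
  ⨆ f ∈ BLoneSeq Θ, |∫ θ, f θ ∂M - ∫ θ, f θ ∂N|

/-- Total variation distance `‖p - q‖ = sup_A |p(A) - q(A)|`. -/
noncomputable def tvDist {E : Type*} [MeasurableSpace E] (p q : Measure E) : ℝ :=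
  ⨆ A : {A : Set E // MeasurableSet A}, |(p A.1).toReal - (q A.1).toReal|

/-- Iterated integral `∫_{A_1} K(x,dy_1) ∫_{A_2} K(y_1,dy_2) ⋯` describing the
finite dimensional distributions of a Markov measure. -/
noncomputable def markovCyl {Θ : Type*} [MeasurableSpace Θ] (K : Θ → Measure Θ) :
    List (Set Θ) → Θ → ℝ≥0∞
  | [], _ => 1
  | A :: rest, x => ∫⁻ y in A, markovCyl K rest y ∂(K x)

/-- `M` is the Markov measure on `Θ^{ℕ₀}` generated by the initial distribution `μ` and the
transition kernel `K`, characterized through its finite dimensional cylinder probabilities. -/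
def IsMarkovMeasure {Θ : Type*} [MeasurableSpace Θ] (M : Measure (ℕ → Θ)) (μ : Measure Θ)
    (K : Θ → Measure Θ) : Prop :=
  ∀ (A₀ : Set Θ) (As : List (Set Θ)), MeasurableSet A₀ → (∀ B ∈ As, MeasurableSet B) →
    M {θ | θ 0 ∈ A₀ ∧ ∀ (i : ℕ) (h : i < As.length), θ (i + 1) ∈ As.get ⟨i, h⟩} =
      ∫⁻ x in A₀, markovCyl K As x ∂μ

/-- The one-sided total variation bound `∫ g dp ≤ ∫ g dq + ε` for all measurable `g ≤ 1`. -/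
def TVBound {E : Type*} [MeasurableSpace E] (p q : Measure E) (ε : ℝ≥0∞) : Prop :=
  ∀ g : E → ℝ≥0∞, Measurable g → (∀ x, g x ≤ 1) → ∫⁻ x, g x ∂p ≤ ∫⁻ x, g x ∂q + ε

theorem TVBound.of_measurableSet {E : Type*} [MeasurableSpace E] {p q : Measure E} {ε : ℝ≥0∞}
    (h : ∀ A, MeasurableSet A → p A ≤ q A + ε) : TVBound p q ε := by
  intro g hg hg1
  have hfin : ∀ x, g x ≠ ∞ := fun x => ((hg1 x).trans_lt one_lt_top).ne
  have hgr : Measurable fun x => (g x).toReal := hg.ennreal_toReal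
  have key : ∀ m : Measure E,
      ∫⁻ x, g x ∂m = ∫⁻ t in Set.Ioi (0 : ℝ), m {a | t < (g a).toReal} := by
    intro m
    rw [← lintegral_eq_lintegral_meas_lt m (ae_of_all _ fun _ => toReal_nonneg) hgr.aemeasurable]
    simp [ofReal_toReal, hfin]
  rw [key p, key q]
  have hle : ∀ t ∈ Set.Ioi (0 : ℝ), p {a | t < (g a).toReal} ≤
      q {a | t < (g a).toReal} + (Set.Ioo (0 : ℝ) 1).indicator (fun _ => ε) t := by
    intro t ht
    by_cases ht1 : t < 1
    · rw [Set.indicator_of_mem (show t ∈ Set.Ioo (0 : ℝ) 1 from ⟨ht, ht1⟩)]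
      exact h _ (measurableSet_lt measurable_const hgr)
    · have : {a | t < (g a).toReal} = ∅ := by
        ext a
        have : (g a).toReal ≤ 1 := toReal_le_of_le_ofReal zero_le_one (by simpa using hg1 a)
        simp only [Set.mem_ofPred_eq, Set.mem_empty_iff_false, iff_false]
        linarith
      simp [this]
  calc _ ≤ ∫⁻ t in Set.Ioi (0 : ℝ), (q {a | t < (g a).toReal} +
        (Set.Ioo (0 : ℝ) 1).indicator (fun _ => ε) t) := setLIntegral_mono' measurableSet_Ioi hle
    _ = (∫⁻ t in Set.Ioi (0 : ℝ), q {a | t < (g a).toReal}) +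
        ∫⁻ t in Set.Ioi (0 : ℝ), (Set.Ioo (0 : ℝ) 1).indicator (fun _ => ε) t :=
      lintegral_add_right _ (measurable_const.indicator measurableSet_Ioo)
    _ ≤ _ := by
      gcongr
      refine (setLIntegral_le_lintegral _ _).trans ?_
      simp [lintegral_indicator measurableSet_Ioo]

theorem TVBound.of_tvDist {E : Type*} [MeasurableSpace E] (p q : Measure E)
    [IsProbabilityMeasure p] [IsProbabilityMeasure q] :
    TVBound p q (ENNReal.ofReal (tvDist p q)) := by
  refine TVBound.of_measurableSet fun A hA => ?_
  have hb : BddAbove (Set.range fun A : {A : Set E // MeasurableSet A} =>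
      |(p A.1).toReal - (q A.1).toReal|) := by
    refine ⟨1, ?_⟩
    rintro _ ⟨A, rfl⟩
    have h1 : (p A.1).toReal ≤ 1 := measureReal_le_one (μ := p) (s := A.1)
    have h2 : (q A.1).toReal ≤ 1 := measureReal_le_one (μ := q) (s := A.1)
    have h3 : 0 ≤ (p A.1).toReal := toReal_nonneg
    have h4 : 0 ≤ (q A.1).toReal := toReal_nonneg
    exact abs_le.2 ⟨by linarith, by linarith⟩
  have h : (p A).toReal - (q A).toReal ≤ tvDist p q :=
    (le_abs_self _).trans (le_ciSup hb ⟨A, hA⟩)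
  calc p A = ENNReal.ofReal (p A).toReal := (ofReal_toReal (measure_ne_top _ _)).symm
    _ ≤ ENNReal.ofReal ((q A).toReal + tvDist p q) := ofReal_le_ofReal (by linarith)
    _ ≤ ENNReal.ofReal (q A).toReal + ENNReal.ofReal (tvDist p q) := ofReal_add_le
    _ = _ := by rw [ofReal_toReal (measure_ne_top _ _)]

theorem tvDist_comm {E : Type*} [MeasurableSpace E] (p q : Measure E) :
    tvDist p q = tvDist q p := by
  simp only [tvDist, abs_sub_comm]

theorem TVBound.map {E F : Type*} [MeasurableSpace E] [MeasurableSpace F] {p q : Measure E}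
    {ε : ℝ≥0∞} (h : TVBound p q ε) {φ : E → F} (hφ : Measurable φ) :
    TVBound (p.map φ) (q.map φ) ε := by
  intro g hg hg1
  rw [lintegral_map hg hφ, lintegral_map hg hφ]
  exact h _ (hg.comp hφ) fun x => hg1 _

/-- A two-sided total variation bound controls integrals of functions with values in `[-1, 1]`. -/
theorem TVBound.abs_integral_sub_le {E : Type*} [MeasurableSpace E] {p q : Measure E}
    [IsProbabilityMeasure p] [IsProbabilityMeasure q] {ε : ℝ} (hε : 0 ≤ ε)
    (hpq : TVBound p q (ENNReal.ofReal ε)) (hqp : TVBound q p (ENNReal.ofReal ε))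
    {f : E → ℝ} (hf : Measurable f) (hf1 : ∀ x, |f x| ≤ 1) :
    |∫ x, f x ∂p - ∫ x, f x ∂q| ≤ 2 * ε := by
  set g : E → ℝ := fun x => (f x + 1) / 2 with hgdef
  have hg : Measurable g := (hf.add_const 1).div_const 2
  have hg0 : ∀ x, 0 ≤ g x := fun x => by have := abs_le.1 (hf1 x); simp only [hgdef]; linarith
  have hg1 : ∀ x, g x ≤ 1 := fun x => by have := abs_le.1 (hf1 x); simp only [hgdef]; linarith
  have hfg : ∀ m : Measure E, IsProbabilityMeasure m → ∫ x, f x ∂m = 2 * ∫ x, g x ∂m - 1 := by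
    intro m _
    have hi : Integrable f m :=
      Integrable.of_bound hf.aestronglyMeasurable 1 (ae_of_all _ fun x => by simpa using hf1 x)
    simp only [hgdef]
    rw [integral_div, integral_add hi (integrable_const _)]
    simp only [integral_const, probReal_univ, smul_eq_mul]
    ring
  have hone : ∀ m n : Measure E, IsProbabilityMeasure m → IsProbabilityMeasure n →
      TVBound m n (ENNReal.ofReal ε) → ∫ x, g x ∂m ≤ ∫ x, g x ∂n + ε := by
    intro m n _ _ h
    rw [integral_eq_lintegral_of_nonneg_ae (ae_of_all _ hg0) hg.aestronglyMeasurable,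
      integral_eq_lintegral_of_nonneg_ae (ae_of_all _ hg0) hg.aestronglyMeasurable]
    have hfin : ∫⁻ x, ENNReal.ofReal (g x) ∂n ≠ ∞ := by
      refine ((lintegral_mono fun x => (ofReal_le_one.2 (hg1 x))).trans_lt ?_).ne
      simp
    have := toReal_mono (add_ne_top.2 ⟨hfin, ofReal_ne_top⟩)
      (h (fun x => ENNReal.ofReal (g x)) hg.ennreal_ofReal fun x => ofReal_le_one.2 (hg1 x))
    rwa [toReal_add hfin ofReal_ne_top, toReal_ofReal hε] at this
  rw [hfg p inferInstance, hfg q inferInstance]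
  have h1 := hone p q inferInstance inferInstance hpq
  have h2 := hone q p inferInstance inferInstance hqp
  exact abs_le.2 ⟨by linarith, by linarith⟩

theorem TVBound.of_compProd {E F : Type*} [MeasurableSpace E] [MeasurableSpace F] {μ ν : Measure E}
    [SFinite μ] [SFinite ν] {κ η : Kernel E F} [IsMarkovKernel κ] [IsMarkovKernel η] {ε : ℝ≥0∞}
    (h : TVBound (μ ⊗ₘ κ) (ν ⊗ₘ η) ε) : TVBound μ ν ε := by
  have := h.map measurable_fst
  rwa [← Measure.fst, ← Measure.fst, Measure.fst_compProd, Measure.fst_compProd] at this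

theorem lintegral_le_one_of_le_one {E : Type*} [MeasurableSpace E] {m : Measure E}
    [IsProbabilityMeasure m] {g : E → ℝ≥0∞} (hg : ∀ x, g x ≤ 1) : ∫⁻ x, g x ∂m ≤ 1 :=
  (lintegral_mono hg).trans (by simp)

theorem measurable_finCons {Θ : Type*} [MeasurableSpace Θ] (k : ℕ) :
    Measurable fun p : Θ × (Fin k → Θ) => (Fin.cons p.1 p.2 : Fin (k + 1) → Θ) := by
  refine measurable_pi_iff.2 fun i => ?_
  refine Fin.cases ?_ (fun j => ?_) i
  · simpa using measurable_fst
  · simpa [Function.comp_def] using (measurable_pi_apply j).comp measurable_snd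

/-- The law of the `k` steps following the starting point of a chain with kernel `K`. -/
noncomputable def pathKernel {Θ : Type*} [MeasurableSpace Θ] (K : Kernel Θ Θ) :
    (k : ℕ) → Kernel Θ (Fin k → Θ)
  | 0 => Kernel.const Θ (Measure.dirac Fin.elim0)
  | k + 1 => (K ⊗ₖ Kernel.prodMkLeft Θ (pathKernel K k)).map fun p => Fin.cons p.1 p.2

instance pathKernel.isMarkovKernel {Θ : Type*} [MeasurableSpace Θ] (K : Kernel Θ Θ)
    [IsMarkovKernel K] : ∀ k, IsMarkovKernel (pathKernel K k)
  | 0 => by unfold pathKernel; infer_instance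
  | k + 1 => by
    have := pathKernel.isMarkovKernel K k
    unfold pathKernel
    exact Kernel.IsMarkovKernel.map _ (measurable_finCons k)

theorem lintegral_pathKernel_succ {Θ : Type*} [MeasurableSpace Θ] (K : Kernel Θ Θ)
    [IsMarkovKernel K] (k : ℕ) (x : Θ) {g : (Fin (k + 1) → Θ) → ℝ≥0∞} (hg : Measurable g) :
    ∫⁻ v, g v ∂pathKernel K (k + 1) x =
      ∫⁻ y, ∫⁻ w, g (Fin.cons y w) ∂pathKernel K k y ∂K x := by
  rw [pathKernel, Kernel.lintegral_map _ (measurable_finCons k) _ hg,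
    Kernel.lintegral_compProd (f := fun p => g (Fin.cons p.1 p.2)) _ _ _
      (hg.comp (measurable_finCons k))]
  rfl

/-- The path kernel realises the iterated integrals of `markovCyl`. -/
theorem pathKernel_pi {Θ : Type*} [MeasurableSpace Θ] (K : Kernel Θ Θ) [IsMarkovKernel K] :
    ∀ (k : ℕ) (A : Fin k → Set Θ), (∀ i, MeasurableSet (A i)) → ∀ x,
      pathKernel K k x (Set.univ.pi A) = markovCyl (fun x => K x) (List.ofFn A) x
  | 0, A, _, x => by
    have : Set.univ.pi A = Set.univ := by ext; simp
    rw [this]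
    simp [markovCyl]
  | k + 1, A, hA, x => by
    have hm : MeasurableSet (Set.univ.pi A) := MeasurableSet.univ_pi hA
    rw [← lintegral_indicator_one hm,
      lintegral_pathKernel_succ K k x (measurable_one.indicator hm), List.ofFn_succ, markovCyl,
      ← lintegral_indicator (hA 0)]
    congr 1
    ext y
    have hcons : ∀ w : Fin k → Θ, (Fin.cons y w : Fin (k + 1) → Θ) ∈ Set.univ.pi A ↔
        y ∈ A 0 ∧ w ∈ Set.univ.pi fun i => A i.succ := by
      intro w
      simp [Set.mem_pi, Fin.forall_fin_succ]
    by_cases hy : y ∈ A 0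
    · rw [Set.indicator_of_mem hy, ← pathKernel_pi K k _ (fun i => hA i.succ),
        ← lintegral_indicator_one (MeasurableSet.univ_pi fun i : Fin k => hA i.succ)]
      congr 1
      ext w
      by_cases hw : w ∈ Set.univ.pi fun i : Fin k => A i.succ
      · rw [Set.indicator_of_mem hw, Set.indicator_of_mem ((hcons w).2 ⟨hy, hw⟩)]
        rfl
      · rw [Set.indicator_of_notMem hw, Set.indicator_of_notMem fun h => hw ((hcons w).1 h).2]
    · rw [Set.indicator_of_notMem hy]
      simp [hcons, hy]

/-- The finite dimensional distributions of a Markov measure. -/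
theorem IsMarkovMeasure.map_prefix {Θ : Type*} [MeasurableSpace Θ] {M : Measure (ℕ → Θ)}
    [IsProbabilityMeasure M] {μ : Measure Θ} [IsProbabilityMeasure μ] {K : Kernel Θ Θ}
    [IsMarkovKernel K] (h : IsMarkovMeasure M μ fun x => K x) (k : ℕ) :
    M.map (fun θ (i : Fin (k + 1)) => θ i) =
      (μ ⊗ₘ pathKernel K k).map fun p => (Fin.cons p.1 p.2 : Fin (k + 1) → Θ) := by
  have hr : Measurable fun (θ : ℕ → Θ) (i : Fin (k + 1)) => θ i :=
    measurable_pi_iff.2 fun i => measurable_pi_apply _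
  have := Measure.isProbabilityMeasure_map (μ := M) hr.aemeasurable
  have := Measure.isProbabilityMeasure_map (μ := μ ⊗ₘ pathKernel K k)
    (measurable_finCons (Θ := Θ) k).aemeasurable
  refine ext_of_generate_finite _ generateFrom_pi.symm isPiSystem_pi ?_ (by simp)
  rintro _ ⟨A, hA, rfl⟩
  have hA' : ∀ i, MeasurableSet (A i) := fun i => hA i (Set.mem_univ i)
  have hm : MeasurableSet (Set.univ.pi A) := MeasurableSet.univ_pi hA'
  rw [Measure.map_apply hr hm, Measure.map_apply (measurable_finCons k) hm]
  have hset : (fun (θ : ℕ → Θ) (i : Fin (k + 1)) => θ i) ⁻¹' Set.univ.pi A =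
      {θ | θ 0 ∈ A 0 ∧ ∀ (i : ℕ) (hi : i < (List.ofFn fun j : Fin k => A j.succ).length),
        θ (i + 1) ∈ (List.ofFn fun j : Fin k => A j.succ).get ⟨i, hi⟩} := by
    ext θ
    simp [Set.mem_pi, Fin.forall_fin_succ, Fin.forall_iff]
  have hpre : (fun p : Θ × (Fin k → Θ) => (Fin.cons p.1 p.2 : Fin (k + 1) → Θ)) ⁻¹'
      Set.univ.pi A = A 0 ×ˢ Set.univ.pi fun j : Fin k => A j.succ := by
    ext p
    simp [Set.mem_pi, Fin.forall_fin_succ]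
  rw [hset, hpre, h _ _ (hA' 0) (by simpa [List.mem_ofFn] using fun j : Fin k => hA' j.succ),
    Measure.compProd_apply_prod (hA' 0) (MeasurableSet.univ_pi fun j : Fin k => hA' j.succ)]
  simp only [pathKernel_pi K k _ fun j => hA' j.succ]

/-- Total variation control of the one-step joint laws propagates to the laws of finite paths:
reversing the first step reduces a path of `k + 1` steps to one of `k` steps. -/
theorem TVBound.compProd_pathKernel {Θ : Type*} [MeasurableSpace Θ] [StandardBorelSpace Θ]
    [Nonempty Θ] {K₁ K₂ : Kernel Θ Θ} [IsMarkovKernel K₁] [IsMarkovKernel K₂]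
    {μ₁ μ₂ : Measure Θ} [IsProbabilityMeasure μ₁] [IsProbabilityMeasure μ₂]
    (hinv : ∀ A, MeasurableSet A → ∫⁻ x, K₂ x A ∂μ₂ = μ₂ A) {ε : ℝ≥0∞}
    (h₁₂ : TVBound (μ₁ ⊗ₘ K₁) (μ₂ ⊗ₘ K₂) ε) (h₂₁ : TVBound (μ₂ ⊗ₘ K₂) (μ₁ ⊗ₘ K₁) ε) (k : ℕ) :
    TVBound (μ₁ ⊗ₘ pathKernel K₁ k) (μ₂ ⊗ₘ pathKernel K₂ k) ((2 * k + 1) * ε) := by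
  induction k with
  | zero =>
    intro g hg hg1
    rw [Measure.lintegral_compProd hg, Measure.lintegral_compProd hg]
    have hz : ∀ (K : Kernel Θ Θ) x, ∫⁻ w, g (x, w) ∂pathKernel K 0 x = g (x, Fin.elim0) := by
      intro K x
      rw [pathKernel, Kernel.const_apply, lintegral_dirac]
    simp only [hz]
    simpa using h₁₂.of_compProd _ (hg.comp measurable_prodMk_right) fun x => hg1 _
  | succ k ih =>
    intro g hg hg1
    set ρ : Measure (Θ × Θ) := (μ₂ ⊗ₘ K₂).map Prod.swap with hρ
    have : IsProbabilityMeasure ρ := Measure.isProbabilityMeasure_map measurable_swap.aemeasurable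
    have hρfst : ρ.fst = μ₂ := by
      ext A hA
      rw [hρ, Measure.fst_map_swap, Measure.snd_compProd, Measure.bind_apply hA K₂.aemeasurable,
        hinv A hA]
    have hdis : μ₂ ⊗ₘ ρ.condKernel = ρ := by
      have := ρ.disintegrate ρ.condKernel
      rwa [hρfst] at this
    -- the test function with the starting point `x` integrated out given the next state `y`
    set gt : Θ × (Fin k → Θ) → ℝ≥0∞ :=
      fun p => ∫⁻ x, g (x, Fin.cons p.1 p.2) ∂ρ.condKernel p.1 with hgt
    have hc : Measurable fun q : Θ × Θ × (Fin k → Θ) =>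
        g (q.1, (Fin.cons q.2.1 q.2.2 : Fin (k + 1) → Θ)) :=
      hg.comp (measurable_fst.prodMk ((measurable_finCons k).comp measurable_snd))
    have hgtm : Measurable gt := by
      have := Measurable.lintegral_kernel_prod_right' (κ := ρ.condKernel.comap
        (Prod.fst : Θ × (Fin k → Θ) → Θ) measurable_fst) (hc.comp measurable_swap)
      exact this
    have hgt1 : ∀ p, gt p ≤ 1 := fun p => lintegral_le_one_of_le_one fun x => hg1 _
    have hmeas : ∀ (L : Kernel Θ Θ) [IsMarkovKernel L], Measurable (fun p : Θ × Θ =>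
        ∫⁻ w, g (p.1, Fin.cons p.2 w) ∂pathKernel L k p.2) := by
      intro L _
      exact Measurable.lintegral_kernel_prod_right' (κ := (pathKernel L k).comap
        (Prod.snd : Θ × Θ → Θ) measurable_snd)
        (hc.comp ((measurable_fst.comp measurable_fst).prodMk
          ((measurable_snd.comp measurable_fst).prodMk measurable_snd)))
    have hexp : ∀ (μ : Measure Θ) [IsProbabilityMeasure μ] (K : Kernel Θ Θ) [IsMarkovKernel K],
        ∫⁻ p, ∫⁻ w, g (p.1, Fin.cons p.2 w) ∂pathKernel K k p.2 ∂(μ ⊗ₘ K) =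
          ∫⁻ p, g p ∂(μ ⊗ₘ pathKernel K (k + 1)) := by
      intro μ _ K _
      rw [Measure.lintegral_compProd hg, Measure.lintegral_compProd (hmeas K)]
      congr 1
      ext x
      exact (lintegral_pathKernel_succ K k x (hg.comp measurable_prodMk_left)).symm
    have hrev : ∀ (L : Kernel Θ Θ) [IsMarkovKernel L],
        ∫⁻ p, ∫⁻ w, g (p.1, Fin.cons p.2 w) ∂pathKernel L k p.2 ∂(μ₂ ⊗ₘ K₂) =
          ∫⁻ p, gt p ∂(μ₂ ⊗ₘ pathKernel L k) := by
      intro L _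
      have hswap : μ₂ ⊗ₘ K₂ = ρ.map Prod.swap := by
        rw [hρ, Measure.map_map measurable_swap measurable_swap]
        simp
      rw [Measure.lintegral_compProd hgtm, hswap,
        lintegral_map (hmeas L) measurable_swap]
      conv_lhs => rw [← hdis]
      refine (Measure.lintegral_compProd ((hmeas L).comp measurable_swap)).trans ?_
      congr 1
      ext y
      simp only [Function.comp_apply, Prod.fst_swap, Prod.snd_swap, hgt]
      exact lintegral_lintegral_swap (hc.comp (measurable_fst.prodMk
        (measurable_const.prodMk measurable_snd))).aemeasurable
    calc ∫⁻ p, g p ∂(μ₁ ⊗ₘ pathKernel K₁ (k + 1))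
        = ∫⁻ p, ∫⁻ w, g (p.1, Fin.cons p.2 w) ∂pathKernel K₁ k p.2 ∂(μ₁ ⊗ₘ K₁) :=
          (hexp μ₁ K₁).symm
      _ ≤ ∫⁻ p, ∫⁻ w, g (p.1, Fin.cons p.2 w) ∂pathKernel K₁ k p.2 ∂(μ₂ ⊗ₘ K₂) + ε :=
          h₁₂ _ (hmeas K₁) fun p => lintegral_le_one_of_le_one fun w => hg1 _
      _ = ∫⁻ y, ∫⁻ w, gt (y, w) ∂pathKernel K₁ k y ∂μ₂ + ε := by
          rw [hrev K₁, Measure.lintegral_compProd hgtm]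
      _ ≤ ∫⁻ y, ∫⁻ w, gt (y, w) ∂pathKernel K₁ k y ∂μ₁ + ε + ε := by
          gcongr
          exact h₂₁.of_compProd _ hgtm.lintegral_kernel_prod_right'
            fun y => lintegral_le_one_of_le_one fun w => hgt1 _
      _ = ∫⁻ p, gt p ∂(μ₁ ⊗ₘ pathKernel K₁ k) + ε + ε := by rw [Measure.lintegral_compProd hgtm]
      _ ≤ ∫⁻ p, gt p ∂(μ₂ ⊗ₘ pathKernel K₂ k) + (2 * k + 1) * ε + ε + ε := by
          gcongr
          exact ih gt hgtm hgt1
      _ = ∫⁻ p, g p ∂(μ₂ ⊗ₘ pathKernel K₂ (k + 1)) + (2 * (k + 1 : ℕ) + 1) * ε := by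
          rw [← hrev K₂, hexp μ₂ K₂]
          push_cast
          ring

theorem dInfty_le_of_eq_prefix {Θ : Type*} [PseudoMetricSpace Θ] (hd : ∀ s t : Θ, dist s t ≤ 1)
    {a b : ℕ → Θ} (m : ℕ) (hab : ∀ i < m, a i = b i) : dInfty a b ≤ (2 : ℝ)⁻¹ ^ m := by
  have hgeo : HasSum (fun i : ℕ => (2 : ℝ)⁻¹ ^ (i + m + 1)) ((2 : ℝ)⁻¹ ^ m) := by
    have h := (hasSum_geometric_of_lt_one (r := (2 : ℝ)⁻¹) (by norm_num) (by norm_num)).mul_left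
      ((2 : ℝ)⁻¹ ^ (m + 1))
    have hv : (2 : ℝ)⁻¹ ^ (m + 1) * (1 - 2⁻¹)⁻¹ = 2⁻¹ ^ m := by
      norm_num [pow_succ, mul_assoc]
    rw [hv] at h
    refine (funext fun i => ?_ : (fun i : ℕ => (2 : ℝ)⁻¹ ^ (i + m + 1)) = _) ▸ h
    ring
  have hle : ∀ i, (2 : ℝ)⁻¹ ^ (i + 1) * dist (a i) (b i) ≤ (2 : ℝ)⁻¹ ^ (i + 1) := fun i =>
    mul_le_of_le_one_right (by positivity) (hd _ _)
  have hsum : Summable fun i : ℕ => (2 : ℝ)⁻¹ ^ (i + 1) * dist (a i) (b i) :=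
    Summable.of_nonneg_of_le (fun i => by positivity) hle
      ((summable_nat_add_iff 1).2 (summable_geometric_of_lt_one (by norm_num) (by norm_num)))
  rw [dInfty, ← hsum.sum_add_tsum_nat_add m, Finset.sum_eq_zero, zero_add, ← hgeo.tsum_eq]
  · exact ((summable_nat_add_iff m).2 hsum).tsum_le_tsum (fun i => hle (i + m)) hgeo.summable
  · intro i hi
    rw [hab i (Finset.mem_range.1 hi), dist_self, mul_zero]

/-- A total variation bound for the laws of the first `m` coordinates bounds `w_∞`. -/
theorem blDistInfty_le_of_prefix {Θ : Type*} [PseudoMetricSpace Θ] [MeasurableSpace Θ] [Nonempty Θ]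
    (hd : ∀ s t : Θ, dist s t ≤ 1) {M N : Measure (ℕ → Θ)} [IsProbabilityMeasure M]
    [IsProbabilityMeasure N] (m : ℕ) {ε : ℝ} (hε : 0 ≤ ε)
    (hMN : TVBound (M.map fun θ (i : Fin m) => θ i) (N.map fun θ (i : Fin m) => θ i)
      (ENNReal.ofReal ε))
    (hNM : TVBound (N.map fun θ (i : Fin m) => θ i) (M.map fun θ (i : Fin m) => θ i)
      (ENNReal.ofReal ε)) :
    blDistInfty M N ≤ 2 * (2 : ℝ)⁻¹ ^ m + 2 * ε := by
  have hB : 0 ≤ 2 * (2 : ℝ)⁻¹ ^ m + 2 * ε := by positivity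
  refine Real.iSup_le (fun f => Real.iSup_le (fun hf => ?_) hB) hB
  obtain ⟨hfm, hfl⟩ := hf
  obtain ⟨c⟩ := ‹Nonempty Θ›
  have hr : Measurable fun (θ : ℕ → Θ) (i : Fin m) => θ i :=
    measurable_pi_iff.2 fun i => measurable_pi_apply _
  set pad : (Fin m → Θ) → ℕ → Θ := fun v i => if h : i < m then v ⟨i, h⟩ else c with hpad
  have hpadm : Measurable pad := by
    refine measurable_pi_iff.2 fun i => ?_
    by_cases h : i < m
    · simpa [hpad, h] using measurable_pi_apply (⟨i, h⟩ : Fin m)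
    · simp [hpad, h]
  set g : (Fin m → Θ) → ℝ := fun v => f (pad v) - f fun _ => c with hg
  have hgm : Measurable g := (hfm.comp hpadm).sub_const _
  have hosc : ∀ a b, |f a - f b| ≤ 1 := fun a b => (hfl a b).trans
    (by simpa using dInfty_le_of_eq_prefix hd (a := a) (b := b) 0 (by simp))
  have hg1 : ∀ v, |g v| ≤ 1 := fun v => hosc _ _
  have happrox : ∀ P : Measure (ℕ → Θ), IsProbabilityMeasure P →
      |∫ θ, f θ ∂P - (∫ v, g v ∂(P.map fun θ (i : Fin m) => θ i) + f fun _ => c)| ≤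
        (2 : ℝ)⁻¹ ^ m := by
    intro P _
    have hfi : Integrable f P := by
      refine Integrable.of_bound hfm.aestronglyMeasurable (1 + |f fun _ => c|)
        (ae_of_all _ fun θ => ?_)
      have := abs_add_le (f θ - f fun _ => c) (f fun _ => c)
      rw [sub_add_cancel] at this
      exact this.trans (by gcongr; exact hosc _ _)
    have hgi : Integrable (fun θ : ℕ → Θ => g fun i : Fin m => θ i) P :=
      Integrable.of_bound (hgm.comp hr).aestronglyMeasurable 1 (ae_of_all _ fun θ =>
        (Real.norm_eq_abs _).trans_le (hg1 fun i => θ i))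
    rw [integral_map hr.aemeasurable hgm.aestronglyMeasurable]
    have heq : ∫ θ, f θ ∂P - (∫ θ, g (fun i : Fin m => θ i) ∂P + f fun _ => c) =
        ∫ θ, (f θ - (g (fun i : Fin m => θ i) + f fun _ => c)) ∂P := by
      have hgc : Integrable (fun θ : ℕ → Θ => g (fun i : Fin m => θ i) + f fun _ => c) P :=
        hgi.add (integrable_const _)
      rw [integral_sub hfi hgc, integral_add hgi (integrable_const _)]
      simp
    rw [heq, ← Real.norm_eq_abs]
    refine (norm_integral_le_of_norm_le_const (C := (2 : ℝ)⁻¹ ^ m)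
      (ae_of_all _ fun θ => ?_)).trans (by simp)
    rw [Real.norm_eq_abs]
    simp only [hg, sub_add_cancel]
    refine (hfl _ _).trans (dInfty_le_of_eq_prefix hd m fun i hi => ?_)
    simp [hpad, hi]
  have := Measure.isProbabilityMeasure_map (μ := M) hr.aemeasurable
  have := Measure.isProbabilityMeasure_map (μ := N) hr.aemeasurable
  have h1 := abs_le.1 (happrox M inferInstance)
  have h2 := abs_le.1 (happrox N inferInstance)
  have h3 := abs_le.1 (hMN.abs_integral_sub_le hε hNM hgm hg1)
  exact abs_le.2 ⟨by linarith, by linarith⟩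

theorem tvDist_nonneg {E : Type*} [MeasurableSpace E] (p q : Measure E) : 0 ≤ tvDist p q :=
  Real.iSup_nonneg fun _ => abs_nonneg _

theorem blDistInfty_nonneg {Θ : Type*} [MeasurableSpace Θ] [PseudoMetricSpace Θ]
    (M N : Measure (ℕ → Θ)) : 0 ≤ blDistInfty M N :=
  Real.iSup_nonneg fun _ => Real.iSup_nonneg fun _ => abs_nonneg _

theorem IsMarkovMeasure.tvBound_map_prefix {Θ : Type*} [MeasurableSpace Θ] [StandardBorelSpace Θ]
    [Nonempty Θ] {K₁ K₂ : Kernel Θ Θ} [IsMarkovKernel K₁] [IsMarkovKernel K₂]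
    {μ₁ μ₂ : Measure Θ} [IsProbabilityMeasure μ₁] [IsProbabilityMeasure μ₂]
    (hinv : ∀ A, MeasurableSet A → ∫⁻ x, K₂ x A ∂μ₂ = μ₂ A)
    {M₁ M₂ : Measure (ℕ → Θ)} [IsProbabilityMeasure M₁] [IsProbabilityMeasure M₂]
    (hM₁ : IsMarkovMeasure M₁ μ₁ fun x => K₁ x) (hM₂ : IsMarkovMeasure M₂ μ₂ fun x => K₂ x)
    (k : ℕ) :
    TVBound (M₁.map fun θ (i : Fin (k + 1)) => θ i) (M₂.map fun θ (i : Fin (k + 1)) => θ i)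
      (ENNReal.ofReal ((2 * k + 1) * tvDist (μ₁ ⊗ₘ K₁) (μ₂ ⊗ₘ K₂))) := by
  have h₁₂ := TVBound.of_tvDist (μ₁ ⊗ₘ K₁) (μ₂ ⊗ₘ K₂)
  have h₂₁ := TVBound.of_tvDist (μ₂ ⊗ₘ K₂) (μ₁ ⊗ₘ K₁)
  rw [tvDist_comm] at h₂₁
  have hc : ENNReal.ofReal ((2 * k + 1) * tvDist (μ₁ ⊗ₘ K₁) (μ₂ ⊗ₘ K₂)) =
      (2 * k + 1) * ENNReal.ofReal (tvDist (μ₁ ⊗ₘ K₁) (μ₂ ⊗ₘ K₂)) := by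
    rw [ofReal_mul (by positivity), ofReal_add (by positivity) zero_le_one,
      ofReal_mul zero_le_two]
    simp
  rw [hM₁.map_prefix, hM₂.map_prefix, hc]
  exact (TVBound.compProd_pathKernel hinv h₁₂ h₂₁ k).map (measurable_finCons k)

/-- Let `Θ` be complete separable with `d ≤ 1`. For `i = 1,2` let `K_n^i` be
Markov kernels on `Θ` with invariant probability measures `Π_n^i` and let `M_n^i` be the
corresponding stationary Markov measures on `Θ^{ℕ₀}`. If `‖Π_n^1 ⊗ K_n^1 − Π_n^2 ⊗ K_n^2‖ → 0`
in total variation, then `w_∞(M_n^1, M_n^2) → 0`. -/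
theorem markov_tv_implies_blDistInfty {Θ : Type*} [MetricSpace Θ] [CompleteSpace Θ]
    [TopologicalSpace.SeparableSpace Θ] [MeasurableSpace Θ] [BorelSpace Θ]
    (hd : ∀ s t : Θ, dist s t ≤ 1)
    (K₁ K₂ : ℕ → Kernel Θ Θ) [∀ n, IsMarkovKernel (K₁ n)] [∀ n, IsMarkovKernel (K₂ n)]
    (pr₁ pr₂ : ℕ → Measure Θ) [∀ n, IsProbabilityMeasure (pr₁ n)]
    [∀ n, IsProbabilityMeasure (pr₂ n)]
    (hinv₁ : ∀ n (A : Set Θ), MeasurableSet A → ∫⁻ x, K₁ n x A ∂(pr₁ n) = pr₁ n A)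
    (hinv₂ : ∀ n (A : Set Θ), MeasurableSet A → ∫⁻ x, K₂ n x A ∂(pr₂ n) = pr₂ n A)
    (M₁ M₂ : ℕ → Measure (ℕ → Θ))
    [∀ n, IsProbabilityMeasure (M₁ n)] [∀ n, IsProbabilityMeasure (M₂ n)]
    (hM₁ : ∀ n, IsMarkovMeasure (M₁ n) (pr₁ n) (fun x => K₁ n x))
    (hM₂ : ∀ n, IsMarkovMeasure (M₂ n) (pr₂ n) (fun x => K₂ n x))
    (htv : Tendsto (fun n => tvDist ((pr₁ n) ⊗ₘ K₁ n) ((pr₂ n) ⊗ₘ K₂ n)) atTop (𝓝 0)) :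
    Tendsto (fun n => blDistInfty (M₁ n) (M₂ n)) atTop (𝓝 0) := by 
  have : Nonempty Θ := nonempty_of_isProbabilityMeasure (pr₁ 0)
  have hbound : ∀ (k n : ℕ), blDistInfty (M₁ n) (M₂ n) ≤ 2 * (2 : ℝ)⁻¹ ^ (k + 1) +
      2 * ((2 * k + 1) * tvDist ((pr₁ n) ⊗ₘ K₁ n) ((pr₂ n) ⊗ₘ K₂ n)) := by
    intro k n
    refine blDistInfty_le_of_prefix hd (k + 1)
      (mul_nonneg (by positivity) (tvDist_nonneg _ _))
      ((hM₁ n).tvBound_map_prefix (hinv₂ n) (hM₂ n) k) ?_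
    rw [tvDist_comm]
    exact (hM₂ n).tvBound_map_prefix (hinv₁ n) (hM₁ n) k
  refine tendsto_order.2 ⟨fun a ha => Eventually.of_forall fun n =>
    ha.trans_le (blDistInfty_nonneg _ _), fun δ hδ => ?_⟩
  obtain ⟨k, hk⟩ := exists_pow_lt_of_lt_one hδ (show (2 : ℝ)⁻¹ < 1 by norm_num)
  have hlim : Tendsto (fun n => 2 * (2 : ℝ)⁻¹ ^ (k + 1) +
      2 * ((2 * k + 1) * tvDist ((pr₁ n) ⊗ₘ K₁ n) ((pr₂ n) ⊗ₘ K₂ n))) atTop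
      (𝓝 ((2 : ℝ)⁻¹ ^ k)) := by
    have := ((htv.const_mul (2 * (k : ℝ) + 1)).const_mul 2).const_add (2 * (2 : ℝ)⁻¹ ^ (k + 1))
    convert this using 2
    rw [pow_succ]
    ring
  filter_upwards [hlim.eventually_lt_const hk] with n hn
  exact (hbound k n).trans_lt hn
end
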